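/- Let φ₀(t) = 2^{1/4} e^{−πt²} and, for R > 0, let 𝔹_R = {(x,ω) ∈ ℝ² : x² + ω² ≤ R²}. For k ∈ ℕ let h_k(t) = e^{πt²} · (d^k/dt^k)(e^{−2πt²}) be the (unnormalized) k-th Hermite function. Then h_k is an eigenfunction of the localization operator H_{𝔹_R, φ₀} f(t) = ∫_{𝔹_R} V_{φ₀} f(x,ω) e^{2πiωt} φ₀(t − x) dx dω, with eigenvalue λ_k(R) = 1 − e^{−πR²} Σ_{j=0}^{k} (πR²)^j / j!; that is, H_{𝔹_R, φ₀} h_k = λ_k(R) · h_k. -/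

import Mathlib

open MeasureTheory

/-- The short-time Fourier transform of `f` with window `φ` at the phase-space
point `z = (x, ω)`: `V_φ f (x, ω) = ∫ f(t) e^{-2πiωt} conj (φ (t - x)) dt`. -/
noncomputable def STFT (φ f : ℝ → ℂ) (z : ℝ × ℝ) : ℂ :=
  ∫ t : ℝ, f t * Complex.exp (-2 * (Real.pi : ℂ) * Complex.I * (z.2 : ℂ) * (t : ℂ)) *
    (starRingEnd ℂ) (φ (t - z.1))

/-- The `L²`-normalized standard Gaussian `φ₀(t) = 2^(1/4) e^(-π t²)`. -/
noncomputable def stdGaussian (t : ℝ) : ℂ :=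
  ((2 : ℝ) ^ ((1 : ℝ) / 4) : ℝ) * Complex.exp (-(Real.pi : ℂ) * (t : ℂ) ^ 2)

/-- The (unnormalized) `k`-th Hermite function
`h_k(t) = e^{π t²} (d/dt)^k e^{-2π t²}`. -/
noncomputable def hermiteFn (k : ℕ) (t : ℝ) : ℂ :=
  Complex.exp ((Real.pi : ℂ) * (t : ℂ) ^ 2) *
    iteratedDeriv k (fun s : ℝ => Complex.exp (-2 * (Real.pi : ℂ) * (s : ℂ) ^ 2)) t

theorem iteratedDeriv_comp_ofReal {g : ℂ → ℂ} (hg : ContDiff ℂ ⊤ g) (k : ℕ) :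
    iteratedDeriv k (fun s : ℝ => g s) = fun s : ℝ => iteratedDeriv k g s := by
  induction k with
  | zero => simp
  | succ n ih =>
    rw [iteratedDeriv_succ, ih]
    ext s
    rw [iteratedDeriv_succ]
    exact ((hg.differentiable_iteratedDeriv n (WithTop.coe_lt_top _)) (s : ℂ)).hasDerivAt.comp_ofReal.deriv

theorem contDiff_cexp_neg_sq : ContDiff ℂ ⊤ (fun w : ℂ => Complex.exp (-2 * (Real.pi : ℂ) * w ^ 2)) := by
  fun_prop

theorem hasDerivAt_exp_mul_sum_pow_div_factorial (k : ℕ) (r : ℝ) :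
    HasDerivAt (fun r : ℝ => -(Real.exp (-Real.pi * r ^ 2) *
        ∑ j ∈ Finset.range (k + 1), (Real.pi * r ^ 2) ^ j / (Nat.factorial j)))
      (2 * Real.pi * r * Real.exp (-Real.pi * r ^ 2) * ((Real.pi * r ^ 2) ^ k / Nat.factorial k)) r := by
  have he : HasDerivAt (fun r : ℝ => Real.exp (-Real.pi * r ^ 2))
      (Real.exp (-Real.pi * r ^ 2) * (-Real.pi * (2 * r))) r := by
    simpa using ((hasDerivAt_pow 2 r).const_mul (-Real.pi)).exp
  induction k with
  | zero =>
    simp only [zero_add, Finset.range_one, Finset.sum_singleton, pow_zero, Nat.factorial_zero,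
      Nat.cast_one, div_one, mul_one]
    exact he.neg.congr_deriv (by ring)
  | succ n ih =>
    have hp : HasDerivAt (fun r : ℝ => (Real.pi * r ^ 2) ^ (n + 1) / ((n + 1).factorial : ℝ))
        ((((n + 1 : ℕ) : ℝ) * (Real.pi * r ^ 2) ^ n * (Real.pi * (2 * r))) /
          ((n + 1).factorial : ℝ)) r := by
      simpa using ((((hasDerivAt_pow 2 r).const_mul Real.pi).pow (n + 1)).div_const
        ((n + 1).factorial : ℝ))
    refine ((ih.fun_sub (he.fun_mul hp)).congr_deriv ?_).congr_of_eventuallyEq (.of_forall fun r => ?_)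
    · rw [Nat.factorial_succ]
      push_cast
      have h1 : (n.factorial : ℝ) ≠ 0 := by positivity
      have h2 : (n : ℝ) + 1 ≠ 0 := by positivity
      field_simp
      ring
    · simp only
      rw [Finset.sum_range_succ _ (n + 1)]
      ring

theorem integral_two_pi_mul_exp_mul_pow (R : ℝ) (k : ℕ) :
    ∫ r in (0 : ℝ)..R, 2 * Real.pi * r * Real.exp (-Real.pi * r ^ 2) *
        ((Real.pi * r ^ 2) ^ k / Nat.factorial k) =
      1 - Real.exp (-Real.pi * R ^ 2) *
          ∑ j ∈ Finset.range (k + 1), (Real.pi * R ^ 2) ^ j / (Nat.factorial j) := by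
  rw [intervalIntegral.integral_eq_sub_of_hasDerivAt
    (fun r _ => hasDerivAt_exp_mul_sum_pow_div_factorial k r)
    (Continuous.intervalIntegrable (by fun_prop) _ _)]
  simp [Finset.sum_range_succ']
  ring

theorem integrable_polynomial_mul_cexp_quadratic (P : Polynomial ℂ) (a : ℂ) :
    Integrable (fun s : ℝ => P.eval (s : ℂ) *
      Complex.exp (-2 * (Real.pi : ℂ) * (s : ℂ) ^ 2 + a * s)) := by
  have key (n : ℕ) : Integrable (fun s : ℝ => (s : ℂ) ^ n *
      Complex.exp (-2 * (Real.pi : ℂ) * (s : ℂ) ^ 2 + a * s)) := by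
    have hb : (-2 * (Real.pi : ℂ)).re < 0 := by simp [Real.pi_pos]
    have h1 := (integrable_cexp_quadratic' hb (a + 1) 0).norm
    have h2 := (integrable_cexp_quadratic' hb (a - 1) 0).norm
    refine ((h1.add h2).const_mul (n.factorial : ℝ)).mono' (by fun_prop) (.of_forall fun s => ?_)
    have hs : |s| ^ n ≤ n.factorial * (Real.exp s + Real.exp (-s)) := by
      have h3 := Real.pow_div_factorial_le_exp |s| (abs_nonneg s) n
      rw [div_le_iff₀ (by positivity)] at h3
      have h4 := Real.exp_abs_le s
      nlinarith [show (0 : ℝ) < n.factorial by positivity]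
    have e1 : Complex.exp (-2 * (Real.pi : ℂ) * (s : ℂ) ^ 2 + (a + 1) * s + 0) =
        Complex.exp (-2 * (Real.pi : ℂ) * (s : ℂ) ^ 2 + a * s) * Complex.exp (s : ℝ) := by
      rw [← Complex.exp_add]; ring_nf
    have e2 : Complex.exp (-2 * (Real.pi : ℂ) * (s : ℂ) ^ 2 + (a - 1) * s + 0) =
        Complex.exp (-2 * (Real.pi : ℂ) * (s : ℂ) ^ 2 + a * s) * Complex.exp ((-s : ℝ) : ℂ) := by
      rw [← Complex.exp_add]; push_cast; ring_nf
    simp only [Pi.add_apply]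
    rw [e1, e2, norm_mul, norm_mul, norm_mul, norm_pow, Complex.norm_real, Real.norm_eq_abs,
      Complex.norm_exp_ofReal, Complex.norm_exp_ofReal, ← mul_add, mul_left_comm, mul_comm]
    gcongr
  simp only [Polynomial.eval_eq_sum_range, Finset.sum_mul, mul_assoc]
  exact integrable_finsetSum _ fun n _ => by simpa [mul_assoc] using (key n).const_mul (P.coeff n)

theorem exists_polynomial_iteratedDeriv_cexp_neg_sq (k : ℕ) : ∃ P : Polynomial ℂ, ∀ w : ℂ,
    iteratedDeriv k (fun w : ℂ => Complex.exp (-2 * (Real.pi : ℂ) * w ^ 2)) w =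
      P.eval w * Complex.exp (-2 * (Real.pi : ℂ) * w ^ 2) := by
  induction k with
  | zero => exact ⟨1, by simp⟩
  | succ n ih =>
    obtain ⟨P, hP⟩ := ih
    refine ⟨P.derivative + P * (Polynomial.C (-4 * (Real.pi : ℂ)) * Polynomial.X), fun w => ?_⟩
    rw [iteratedDeriv_succ, funext hP]
    have he : HasDerivAt (fun w : ℂ => Complex.exp (-2 * (Real.pi : ℂ) * w ^ 2))
        (Complex.exp (-2 * (Real.pi : ℂ) * w ^ 2) * (-2 * (Real.pi : ℂ) * (2 * w))) w := by
      simpa using ((hasDerivAt_pow 2 w).const_mul (-2 * (Real.pi : ℂ))).cexp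
    rw [((P.hasDerivAt w).fun_mul he).deriv]
    simp
    ring

theorem integrable_iteratedDeriv_cexp_neg_sq_mul (k : ℕ) (a : ℂ) :
    Integrable (fun s : ℝ => iteratedDeriv k
      (fun w : ℂ => Complex.exp (-2 * (Real.pi : ℂ) * w ^ 2)) (s : ℂ) * Complex.exp (a * s)) := by
  obtain ⟨P, hP⟩ := exists_polynomial_iteratedDeriv_cexp_neg_sq k
  simp only [hP, mul_assoc (P.eval _), ← Complex.exp_add]
  exact integrable_polynomial_mul_cexp_quadratic P a

theorem integral_iteratedDeriv_cexp_neg_sq_mul (k : ℕ) (a : ℂ) :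
    ∫ s : ℝ, iteratedDeriv k
      (fun w : ℂ => Complex.exp (-2 * (Real.pi : ℂ) * w ^ 2)) (s : ℂ) * Complex.exp (a * s) =
    (-a) ^ k * ((2 : ℝ) ^ (-(1 : ℝ) / 2) : ℝ) * Complex.exp (a ^ 2 / (8 * Real.pi)) := by
  induction k with
  | zero =>
    have hb : (-2 * (Real.pi : ℂ)).re < 0 := by simp [Real.pi_pos]
    have h := integral_cexp_quadratic hb a 0
    simp only [iteratedDeriv_zero, pow_zero, one_mul, ← Complex.exp_add]
    simp only [add_zero] at h
    have hpi : (Real.pi : ℂ) ≠ 0 := by exact_mod_cast Real.pi_ne_zero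
    have h2 : (Real.pi : ℂ) / -(-2 * (Real.pi : ℂ)) = ((2⁻¹ : ℝ) : ℂ) := by
      push_cast; field_simp
    have h3 : 0 - a ^ 2 / (4 * (-2 * (Real.pi : ℂ))) = a ^ 2 / (8 * Real.pi) := by
      field_simp; ring
    have h4 : (2⁻¹ : ℝ) ^ ((1 : ℝ) / 2) = (2 : ℝ) ^ (-(1 : ℝ) / 2) := by
      rw [Real.inv_rpow (by norm_num), neg_div, Real.rpow_neg (by norm_num)]
    rw [h, h2, h3, ← h4, Complex.ofReal_cpow (by norm_num)]
    norm_num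
  | succ n ih =>
    have hu (s : ℝ) : HasDerivAt (fun s : ℝ => iteratedDeriv n
        (fun w : ℂ => Complex.exp (-2 * (Real.pi : ℂ) * w ^ 2)) (s : ℂ)) (iteratedDeriv (n + 1)
        (fun w : ℂ => Complex.exp (-2 * (Real.pi : ℂ) * w ^ 2)) (s : ℂ)) s := by
      rw [iteratedDeriv_succ]
      exact ((contDiff_cexp_neg_sq.differentiable_iteratedDeriv n
        (WithTop.coe_lt_top _)) (s : ℂ)).hasDerivAt.comp_ofReal
    have hv (s : ℝ) : HasDerivAt (fun s : ℝ => Complex.exp (a * s)) (Complex.exp (a * s) * a) s := by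
      simpa using ((hasDerivAt_id (s : ℂ)).const_mul a).cexp.comp_ofReal
    have hI := integrable_iteratedDeriv_cexp_neg_sq_mul n a
    have h := integral_mul_deriv_eq_deriv_mul_of_integrable (fun s _ => hu s) (fun s _ => hv s)
      (by simpa only [Pi.mul_def, mul_assoc] using hI.mul_const a)
      (integrable_iteratedDeriv_cexp_neg_sq_mul (n + 1) a) hI
    simp only [← mul_assoc, integral_mul_const] at h
    rw [ih] at h
    rw [← neg_eq_iff_eq_neg.mpr h]
    ring

theorem integral_angle_conj_pow_mul {G : ℂ → ℂ} (hG : Differentiable ℂ G) (k : ℕ) {r : ℝ}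
    (hr : 0 < r) :
    ∫ θ in Set.Ioo (-Real.pi) Real.pi,
        (r * Complex.exp (-(θ * Complex.I))) ^ k * G (r * Complex.exp (θ * Complex.I)) =
      2 * Real.pi * r ^ (2 * k) / k.factorial * iteratedDeriv k G 0 := by
  have hr' : (r : ℂ) ≠ 0 := by exact_mod_cast hr.ne'
  have hper : Function.Periodic (fun θ : ℝ => (r * Complex.exp (-(θ * Complex.I))) ^ k *
      G (r * Complex.exp (θ * Complex.I))) (2 * Real.pi) := by
    intro θ
    have h1 : Complex.exp (((θ + 2 * Real.pi : ℝ) : ℂ) * Complex.I) = Complex.exp (θ * Complex.I) := by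
      rw [← Complex.exp_periodic (θ * Complex.I)]
      push_cast
      ring_nf
    simp only [Complex.exp_neg, h1]
  have h := hG.differentiableOn.circleIntegral_one_div_sub_center_pow_smul (c := 0) hr k
  have h2 : (∮ z in C(0, r), (1 / (z - 0) ^ (k + 1)) • G z) =
      Complex.I / r ^ (2 * k) * ∫ θ in (0 : ℝ)..2 * Real.pi,
        (r * Complex.exp (-(θ * Complex.I))) ^ k * G (r * Complex.exp (θ * Complex.I)) := by
    rw [circleIntegral, ← intervalIntegral.integral_const_mul]
    congr 1
    ext θ
    have he := Complex.exp_ne_zero (θ * Complex.I)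
    simp only [deriv_circleMap, circleMap_zero, sub_zero, smul_eq_mul, Complex.exp_neg, mul_pow, inv_pow]
    field_simp
    ring
  rw [h2] at h
  rw [← integral_Ioc_eq_integral_Ioo, ← intervalIntegral.integral_of_le (by linarith [Real.pi_pos]),
    show Real.pi = -Real.pi + 2 * Real.pi by ring]
  simp only [neg_add_rev]
  rw [show -(2 * Real.pi) + - -Real.pi = -Real.pi by ring, hper.intervalIntegral_add_eq (-Real.pi) 0,
    zero_add]
  rw [smul_eq_mul, div_mul_eq_mul_div, div_eq_iff (pow_ne_zero _ hr')] at h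
  apply mul_left_cancel₀ Complex.I_ne_zero
  rw [h, ← sub_eq_zero]
  ring_nf

theorem integral_disc_conj_pow_mul {G : ℂ → ℂ} (hG : Differentiable ℂ G) (k : ℕ) {R : ℝ}
    (hR : 0 < R) :
    ∫ z in {z : ℝ × ℝ | z.1 ^ 2 + z.2 ^ 2 ≤ R ^ 2}, Real.exp (-Real.pi * (z.1 ^ 2 + z.2 ^ 2)) *
        ((z.1 - z.2 * Complex.I) ^ k * G (z.1 + z.2 * Complex.I)) =
      (∫ r in (0 : ℝ)..R, 2 * Real.pi * r * Real.exp (-Real.pi * r ^ 2) *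
        (r ^ (2 * k) / k.factorial) : ℝ) * iteratedDeriv k G 0 := by
  set F : ℝ × ℝ → ℂ := fun z => Real.exp (-Real.pi * (z.1 ^ 2 + z.2 ^ 2)) *
        ((z.1 - z.2 * Complex.I) ^ k * G (z.1 + z.2 * Complex.I)) with hF
  set H : ℝ × ℝ → ℂ := fun p => (p.1 * Real.exp (-Real.pi * p.1 ^ 2) : ℝ) *
    ((p.1 * Complex.exp (-(p.2 * Complex.I))) ^ k * G (p.1 * Complex.exp (p.2 * Complex.I))) with hH
  have hGc := hG.continuous
  have hms : MeasurableSet {z : ℝ × ℝ | z.1 ^ 2 + z.2 ^ 2 ≤ R ^ 2} :=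
    measurableSet_le (by fun_prop) (by fun_prop)
  have hpol (p : ℝ × ℝ) : p.1 • F (polarCoord.symm p) = H p := by
    have e1 : ((p.1 * Real.cos p.2 : ℝ) : ℂ) + (p.1 * Real.sin p.2 : ℝ) * Complex.I =
        p.1 * Complex.exp (p.2 * Complex.I) := by
      rw [Complex.exp_mul_I]; push_cast; ring
    have e2 : ((p.1 * Real.cos p.2 : ℝ) : ℂ) - (p.1 * Real.sin p.2 : ℝ) * Complex.I =
        p.1 * Complex.exp (-(p.2 * Complex.I)) := by
      rw [← neg_mul, Complex.exp_mul_I, Complex.cos_neg, Complex.sin_neg]; push_cast; ring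
    have e3 : (p.1 * Real.cos p.2) ^ 2 + (p.1 * Real.sin p.2) ^ 2 = p.1 ^ 2 := by
      linear_combination p.1 ^ 2 * Real.sin_sq_add_cos_sq p.2
    simp only [hF, hH, polarCoord_symm_apply, e1, e2, e3, Complex.real_smul]
    push_cast
    ring
  have hind : ∀ p ∈ Set.Ioi (0 : ℝ) ×ˢ Set.Ioo (-Real.pi) Real.pi,
      p.1 • Set.indicator {z : ℝ × ℝ | z.1 ^ 2 + z.2 ^ 2 ≤ R ^ 2} F (polarCoord.symm p) =
      Set.indicator (Set.Iic R ×ˢ Set.univ) H p := by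
    rintro p ⟨hp, -⟩
    have hiff : polarCoord.symm p ∈ {z : ℝ × ℝ | z.1 ^ 2 + z.2 ^ 2 ≤ R ^ 2} ↔
        p ∈ Set.Iic R ×ˢ (Set.univ : Set ℝ) := by
      have e3 : (p.1 * Real.cos p.2) ^ 2 + (p.1 * Real.sin p.2) ^ 2 = p.1 ^ 2 := by
        linear_combination p.1 ^ 2 * Real.sin_sq_add_cos_sq p.2
      simp only [polarCoord_symm_apply, Set.mem_ofPred_eq, e3, Set.mem_prod, Set.mem_Iic,
        Set.mem_univ, and_true]
      exact pow_le_pow_iff_left₀ (Set.mem_Ioi.1 hp).le hR.le two_ne_zero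
    by_cases h : p ∈ Set.Iic R ×ˢ (Set.univ : Set ℝ)
    · rw [Set.indicator_of_mem (hiff.2 h), Set.indicator_of_mem h, hpol]
    · rw [Set.indicator_of_notMem (mt hiff.1 h), Set.indicator_of_notMem h, smul_zero]
  have hHint : IntegrableOn H (Set.Ioc 0 R ×ˢ Set.Ioo (-Real.pi) Real.pi) := by
    refine (ContinuousOn.integrableOn_compact (K := Set.Icc 0 R ×ˢ Set.Icc (-Real.pi) Real.pi)
      (isCompact_Icc.prod isCompact_Icc) (Continuous.continuousOn (by fun_prop))).mono_set ?_
    exact Set.prod_mono Set.Ioc_subset_Icc_self Set.Ioo_subset_Icc_self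
  rw [← integral_indicator hms, ← integral_comp_polarCoord_symm, polarCoord_target,
    setIntegral_congr_fun (measurableSet_Ioi.prod measurableSet_Ioo) hind,
    setIntegral_indicator (measurableSet_Iic.prod MeasurableSet.univ), Set.prod_inter_prod,
    Set.inter_univ, Set.Ioi_inter_Iic, Measure.volume_eq_prod, setIntegral_prod _ hHint,
    ← intervalIntegral.integral_ofReal, intervalIntegral.integral_of_le hR.le, ← integral_mul_const]
  refine setIntegral_congr_fun measurableSet_Ioc fun r hr => ?_
  simp only [hH, integral_const_mul, integral_angle_conj_pow_mul hG k hr.1]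
  push_cast
  ring

theorem STFT_stdGaussian_hermiteFn (k : ℕ) (z : ℝ × ℝ) :
    STFT stdGaussian (hermiteFn k) z =
      ((2 : ℝ) ^ ((1 : ℝ) / 4) : ℝ) * ((2 : ℝ) ^ (-(1 : ℝ) / 2) : ℝ) *
        (-(2 * Real.pi)) ^ k * (z.1 - z.2 * Complex.I) ^ k *
        Complex.exp (Real.pi / 2 * (z.1 - z.2 * Complex.I) ^ 2 - Real.pi * z.1 ^ 2) := by
  have h := integral_iteratedDeriv_cexp_neg_sq_mul k (2 * Real.pi * (z.1 - z.2 * Complex.I))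
  have hpt (s : ℝ) : hermiteFn k s *
      Complex.exp (-2 * (Real.pi : ℂ) * Complex.I * (z.2 : ℂ) * (s : ℂ)) *
      (starRingEnd ℂ) (stdGaussian (s - z.1)) =
      ((2 : ℝ) ^ ((1 : ℝ) / 4) : ℝ) * Complex.exp (-(Real.pi * z.1 ^ 2)) * (iteratedDeriv k
      (fun w : ℂ => Complex.exp (-2 * (Real.pi : ℂ) * w ^ 2)) (s : ℂ) *
        Complex.exp (2 * Real.pi * (z.1 - z.2 * Complex.I) * s)) := by
    have hc : (starRingEnd ℂ) (stdGaussian (s - z.1)) = stdGaussian (s - z.1) := by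
      rw [stdGaussian, map_mul, Complex.conj_ofReal, ← Complex.exp_conj]
      simp
    have he : Complex.exp (Real.pi * (s : ℂ) ^ 2) *
        Complex.exp (-2 * (Real.pi : ℂ) * Complex.I * (z.2 : ℂ) * (s : ℂ)) *
        Complex.exp (-(Real.pi : ℂ) * ((s - z.1 : ℝ) : ℂ) ^ 2) =
        Complex.exp (-(Real.pi * z.1 ^ 2)) *
          Complex.exp (2 * Real.pi * (z.1 - z.2 * Complex.I) * s) := by
      simp only [← Complex.exp_add]
      push_cast
      ring_nf
    rw [hc, hermiteFn, stdGaussian, iteratedDeriv_comp_ofReal contDiff_cexp_neg_sq]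
    linear_combination ((2 : ℝ) ^ ((1 : ℝ) / 4) : ℝ) * iteratedDeriv k
      (fun w : ℂ => Complex.exp (-2 * (Real.pi : ℂ) * w ^ 2)) (s : ℂ) * he
  have hpi : (Real.pi : ℂ) ≠ 0 := by exact_mod_cast Real.pi_ne_zero
  have he : Complex.exp (Real.pi / 2 * (z.1 - z.2 * Complex.I) ^ 2 - Real.pi * z.1 ^ 2) =
      Complex.exp (-(Real.pi * z.1 ^ 2)) *
        Complex.exp ((2 * Real.pi * (z.1 - z.2 * Complex.I)) ^ 2 / (8 * Real.pi)) := by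
    rw [← Complex.exp_add]
    congr 1
    field_simp
    ring
  simp only [STFT, hpt, integral_const_mul, h, he]
  rw [show -(2 * Real.pi * (z.1 - z.2 * Complex.I)) = -(2 * Real.pi) * (z.1 - z.2 * Complex.I) by ring,
    mul_pow]
  ring

theorem iteratedDeriv_hermite_generating (k : ℕ) (t : ℂ) :
    iteratedDeriv k (fun w : ℂ => Complex.exp (2 * Real.pi * t * w - Real.pi / 2 * w ^ 2)) 0 =
      Complex.exp (2 * Real.pi * t ^ 2) * ((-1 / 2) ^ k *
        iteratedDeriv k (fun w : ℂ => Complex.exp (-2 * (Real.pi : ℂ) * w ^ 2)) t) := by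
  have h1 : (fun w : ℂ => Complex.exp (2 * Real.pi * t * w - Real.pi / 2 * w ^ 2)) =
      fun w => Complex.exp (2 * Real.pi * t ^ 2) *
        (fun v : ℂ => Complex.exp (-2 * (Real.pi : ℂ) * (t + v) ^ 2)) (-1 / 2 * w) := by
    ext w
    simp only [← Complex.exp_add]
    ring_nf
  have h2 := congrFun (iteratedDeriv_comp_const_add k
    (fun w : ℂ => Complex.exp (-2 * (Real.pi : ℂ) * w ^ 2)) t) 0
  have h3 := congrFun (iteratedDeriv_comp_const_mul (n := k)
    (f := fun v : ℂ => Complex.exp (-2 * (Real.pi : ℂ) * (t + v) ^ 2)) (by fun_prop) (-1 / 2)) 0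
  rw [h1, iteratedDeriv_const_mul_field, h3]
  simp only [mul_zero, h2, add_zero]

/-- Daubechies' theorem: the Hermite functions are eigenfunctions of the
localization operator on the disc `𝔹_R` with Gaussian window, with
eigenvalues `λ_k(R) = 1 - e^{-πR²} Σ_{j≤k} (πR²)^j / j!`. -/
theorem stmt16 (R : ℝ) (hR : 0 < R) (k : ℕ) (t : ℝ) :
    (∫ z in {z : ℝ × ℝ | z.1 ^ 2 + z.2 ^ 2 ≤ R ^ 2},
        STFT stdGaussian (hermiteFn k) z *
          Complex.exp (2 * (Real.pi : ℂ) * Complex.I * (z.2 : ℂ) * (t : ℂ)) *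
          stdGaussian (t - z.1)) =
      ((1 - Real.exp (-Real.pi * R ^ 2) *
          ∑ j ∈ Finset.range (k + 1), (Real.pi * R ^ 2) ^ j / (Nat.factorial j) : ℝ) : ℂ) *
        hermiteFn k t := by
  have hpt (z : ℝ × ℝ) : STFT stdGaussian (hermiteFn k) z *
          Complex.exp (2 * (Real.pi : ℂ) * Complex.I * (z.2 : ℂ) * (t : ℂ)) *
          stdGaussian (t - z.1) =
      ((-(2 * Real.pi)) ^ k * Complex.exp (-(Real.pi * t ^ 2))) *
        (Real.exp (-Real.pi * (z.1 ^ 2 + z.2 ^ 2)) * ((z.1 - z.2 * Complex.I) ^ k *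
          (fun w : ℂ => Complex.exp (2 * Real.pi * t * w - Real.pi / 2 * w ^ 2))
            (z.1 + z.2 * Complex.I))) := by
    have hc : (((2 : ℝ) ^ ((1 : ℝ) / 4) : ℝ) : ℂ) * ((2 : ℝ) ^ (-(1 : ℝ) / 2) : ℝ) *
        ((2 : ℝ) ^ ((1 : ℝ) / 4) : ℝ) = 1 := by
      simp only [← Complex.ofReal_mul, ← Real.rpow_add two_pos]
      norm_num
    have he : Complex.exp (Real.pi / 2 * (z.1 - z.2 * Complex.I) ^ 2 - Real.pi * z.1 ^ 2) *
        Complex.exp (2 * (Real.pi : ℂ) * Complex.I * (z.2 : ℂ) * (t : ℂ)) *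
        Complex.exp (-(Real.pi : ℂ) * ((t - z.1 : ℝ) : ℂ) ^ 2) =
        Complex.exp (-(Real.pi * t ^ 2)) * (Real.exp (-Real.pi * (z.1 ^ 2 + z.2 ^ 2)) *
          Complex.exp (2 * Real.pi * t * (z.1 + z.2 * Complex.I) -
            Real.pi / 2 * (z.1 + z.2 * Complex.I) ^ 2)) := by
      simp only [Complex.ofReal_exp, ← Complex.exp_add]
      congr 1
      push_cast
      linear_combination (Real.pi * z.2 ^ 2 : ℂ) * Complex.I_sq
    rw [STFT_stdGaussian_hermiteFn, stdGaussian]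
    linear_combination (-(2 * Real.pi : ℂ)) ^ k * (z.1 - z.2 * Complex.I) ^ k *
      (he + Complex.exp (Real.pi / 2 * (z.1 - z.2 * Complex.I) ^ 2 - Real.pi * z.1 ^ 2) *
        Complex.exp (2 * (Real.pi : ℂ) * Complex.I * (z.2 : ℂ) * (t : ℂ)) *
        Complex.exp (-(Real.pi : ℂ) * ((t - z.1 : ℝ) : ℂ) ^ 2) * hc)
  have hint : (1 - Real.exp (-Real.pi * R ^ 2) *
        ∑ j ∈ Finset.range (k + 1), (Real.pi * R ^ 2) ^ j / (Nat.factorial j)) =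
      Real.pi ^ k * ∫ r in (0 : ℝ)..R, 2 * Real.pi * r * Real.exp (-Real.pi * r ^ 2) *
        (r ^ (2 * k) / k.factorial) := by
    rw [← integral_two_pi_mul_exp_mul_pow, ← intervalIntegral.integral_const_mul]
    congr 1
    ext r
    rw [mul_pow, ← pow_mul]
    ring
  have hexp : Complex.exp (-(Real.pi * t ^ 2)) * Complex.exp (2 * Real.pi * t ^ 2) =
      Complex.exp (Real.pi * t ^ 2) := by
    rw [← Complex.exp_add]
    ring_nf
  have hpow : (-(2 * Real.pi) : ℂ) ^ k * (-1 / 2) ^ k = Real.pi ^ k := by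
    rw [← mul_pow]
    ring_nf
  have hdisc := integral_disc_conj_pow_mul
    (G := fun w : ℂ => Complex.exp (2 * Real.pi * t * w - Real.pi / 2 * w ^ 2)) (by fun_prop) k hR
  simp only [hpt]
  rw [integral_const_mul, hdisc,
    iteratedDeriv_hermite_generating, hint, hermiteFn,
    iteratedDeriv_comp_ofReal contDiff_cexp_neg_sq, ← hexp, Complex.ofReal_mul,
    Complex.ofReal_pow, ← hpow]
  ring
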